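/- (Alfvén waves are exact nonlinear solutions of ideal LAMHD-α.) Let α ≥ 0, let ε = ±1, and let v : ℝ³ → ℝ³ be any smooth vector field with div v = 0 everywhere. Define the time-independent fields u_s(t,x) = v(x), B_s(t,x) = ε v(x), u = B/ε = (1−α²Δ)v, and π(t,x) = −v(x)·((1−α²Δ)v)(x). Then (u_s, B_s, π) solves the LAMHD-α system with ν = η = 0; that is, ∂_t u + (u_s·∇)u − (B_s·∇)B + (∇u_s)ᵀ·u + (∇B)ᵀ·B_s + ∇π = 0 and ∂_t B_s + (u_s·∇)B_s − (B_s·∇)u_s = 0 hold at every point. -/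

import Mathlib

open Matrix MeasureTheory

noncomputable section

abbrev V3 := Fin 3 → ℝ

/-- Partial derivative `∂_j f` of a scalar field on ℝ³. -/
def pd (j : Fin 3) (f : V3 → ℝ) (x : V3) : ℝ := fderiv ℝ f x (Pi.single j 1)

/-- Jacobian matrix field: `(∇f)_{ij} = ∂f_i/∂x_j`. -/
def grad (f : V3 → V3) (x : V3) : Matrix (Fin 3) (Fin 3) ℝ :=
  Matrix.of fun i j => pd j (fun y => f y i) x

/-- Divergence of a vector field. -/
def divV (f : V3 → V3) (x : V3) : ℝ := ∑ j, pd j (fun y => f y j) x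

/-- Divergence of a matrix field: `(div M)_i = Σ_j ∂_j M_{ij}`. -/
def divM (M : V3 → Matrix (Fin 3) (Fin 3) ℝ) (x : V3) (i : Fin 3) : ℝ :=
  ∑ j, pd j (fun y => M y i j) x

/-- Scalar Laplacian. -/
def lapS (φ : V3 → ℝ) (x : V3) : ℝ := ∑ j, pd j (fun y => pd j φ y) x

/-- Componentwise Laplacian of a vector field. -/
def lap (f : V3 → V3) (x : V3) (i : Fin 3) : ℝ := lapS (fun y => f y i) x

/-- Helmholtz operator `(1 - α²Δ)` on vector fields. -/
def helm (α : ℝ) (f : V3 → V3) (x : V3) (i : Fin 3) : ℝ := f x i - α ^ 2 * lap f x i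

/-- Helmholtz operator `(1 - α²Δ)` on scalar fields. -/
def helmS (α : ℝ) (φ : V3 → ℝ) (x : V3) : ℝ := φ x - α ^ 2 * lapS φ x

/-- Advection `(g·∇)f = Σ_j g_j ∂_j f`. -/
def advect (g f : V3 → V3) (x : V3) (i : Fin 3) : ℝ :=
  ∑ j, g x j * pd j (fun y => f y i) x

/-- `(∇f)ᵀ·g`, pointwise matrix-vector product. -/
def gradTvec (f g : V3 → V3) (x : V3) (i : Fin 3) : ℝ :=
  ∑ j, (grad f x)ᵀ i j * g x j

/-- Gradient of a scalar field. -/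
def gradS (φ : V3 → ℝ) (x : V3) (i : Fin 3) : ℝ := pd i φ x

/-- Pointwise squared Euclidean norm `|f|²`. -/
def normSq (f : V3 → V3) (x : V3) : ℝ := ∑ i, (f x i) ^ 2

/-- Squared Frobenius norm of the Jacobian, `|∇f|²`. -/
def gradNormSq (f : V3 → V3) (x : V3) : ℝ := ∑ i, ∑ j, (grad f x i j) ^ 2

/-- Spatial tslice at time `t` of a time-dependent vector field. -/
def tslice (f : ℝ × V3 → V3) (t : ℝ) : V3 → V3 := fun x => f (t, x)

theorem pd_const_mul (j : Fin 3) (c : ℝ) (f : V3 → ℝ) (x : V3) :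
    pd j (fun y => c * f y) x = c * pd j f x := by
  simp only [pd]
  rw [show (fun y => c * f y) = c • f from rfl, fderiv_const_smul_field]
  rfl

theorem pd_neg_dot (j : Fin 3) {f g : V3 → V3} {x : V3}
    (hf : DifferentiableAt ℝ f x) (hg : DifferentiableAt ℝ g x) :
    pd j (fun y => -(∑ k, f y k * g y k)) x =
      -∑ k, (pd j (fun y => f y k) x * g x k + pd j (fun y => g y k) x * f x k) := by
  have hf' : ∀ k, DifferentiableAt ℝ (fun y => f y k) x := differentiableAt_pi.1 hf
  have hg' : ∀ k, DifferentiableAt ℝ (fun y => g y k) x := differentiableAt_pi.1 hg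
  have h := (HasFDerivAt.fun_sum (u := Finset.univ)
    fun k _ => (hf' k).hasFDerivAt.mul (hg' k).hasFDerivAt).neg
  have h' : HasFDerivAt (fun y => -(∑ k, f y k * g y k)) _ x := h
  unfold pd
  rw [h'.fderiv]
  simp only [_root_.neg_apply, _root_.sum_apply, _root_.add_apply, _root_.smul_apply, smul_eq_mul]
  congr 1
  exact Finset.sum_congr rfl fun k _ => by ring

theorem contDiff_pd (j : Fin 3) {f : V3 → ℝ} (hf : ContDiff ℝ (⊤ : ℕ∞) f) :
    ContDiff ℝ (⊤ : ℕ∞) (pd j f) :=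
  (hf.fderiv_right (m := (⊤ : ℕ∞)) le_rfl).clm_apply contDiff_const

theorem contDiff_helm (α : ℝ) {f : V3 → V3} (hf : ContDiff ℝ (⊤ : ℕ∞) f) :
    ContDiff ℝ (⊤ : ℕ∞) (helm α f) := by
  refine contDiff_pi.2 fun i => ?_
  have hi : ContDiff ℝ (⊤ : ℕ∞) fun y => f y i := contDiff_pi.1 hf i
  have hl : ContDiff ℝ (⊤ : ℕ∞) fun y => lap f y i :=
    ContDiff.sum (s := Finset.univ) fun j _ => contDiff_pd j (contDiff_pd j hi)
  exact hi.sub (contDiff_const.mul hl)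

/-- Alfvén waves are exact nonlinear solutions of ideal LAMHD-α.
With `u_s(t,x) = v(x)`, `B_s(t,x) = ε v(x)`, `u = (1−α²Δ)v`, `B = ε (1−α²Δ)v`, and
`π(t,x) = −v(x)·((1−α²Δ)v)(x)`, both the ideal motion equation and the ideal
induction equation hold at every point. -/
theorem alfven_waves_solve_lamhd (α : ℝ) (hα : 0 ≤ α) (ε : ℝ) (hε : ε = 1 ∨ ε = -1)
    (v : V3 → V3) (hv : ContDiff ℝ (⊤ : ℕ∞) v) (hdiv : ∀ x : V3, divV v x = 0) :
    (∀ t : ℝ, ∀ x : V3, ∀ i : Fin 3,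
        deriv (fun _s : ℝ => helm α v x i) t
          + advect v (helm α v) x i
          - advect (fun y j => ε * v y j) (fun y j => ε * helm α v y j) x i
          + gradTvec v (helm α v) x i
          + gradTvec (fun y j => ε * helm α v y j) (fun y j => ε * v y j) x i
          + gradS (fun y => -(∑ k, v y k * helm α v y k)) x i = 0) ∧
    (∀ t : ℝ, ∀ x : V3, ∀ i : Fin 3,
        deriv (fun _s : ℝ => ε * v x i) t
          + advect v (fun y j => ε * v y j) x i
          - advect (fun y j => ε * v y j) v x i = 0) := by
  have hε2 : ε * ε = 1 := by rcases hε with rfl | rfl <;> norm_num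
  have hd : Differentiable ℝ v := hv.differentiable (by simp)
  have hh : Differentiable ℝ (helm α v) := (contDiff_helm α hv).differentiable (by simp)
  refine ⟨fun t x i => ?_, fun t x i => ?_⟩
  · simp only [deriv_const, advect, gradTvec, gradS, grad, Matrix.transpose_apply,
      Matrix.of_apply, pd_const_mul, pd_neg_dot i (hd x) (hh x)]
    simp only [Fin.sum_univ_three]
    linear_combination (-(v x 0 * pd 0 (fun y => helm α v y i) x
      + v x 1 * pd 1 (fun y => helm α v y i) x + v x 2 * pd 2 (fun y => helm α v y i) x)
      + (pd i (fun y => helm α v y 0) x * v x 0 + pd i (fun y => helm α v y 1) x * v x 1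
      + pd i (fun y => helm α v y 2) x * v x 2)) * hε2
  · simp only [deriv_const, advect, pd_const_mul, Fin.sum_univ_three]
    ring
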